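/- Let k ≥ 1, r = 2k+1, and 0 ≤ m ≤ k. Then in ℚ[[q]]: Σ_{λ_1 ≥ … ≥ λ_r ≥ 0} (q^{Σ_{i=1}^r λ_i(λ_i+1)/2} / (q)_λ) · (1 + Σ_{i=0}^{m−1} q^{Σ_{j=0}^{i} (λ_{r−1−2j} + 1)}) = (−q)_∞ · Σ_{μ_1 ≥ … ≥ μ_k ≥ 0} (q^{Σ_{i=1}^k (μ_i² + μ_i)} / (q)_μ) · (1 + Σ_{i=0}^{m−1} q^{Σ_{j=0}^{i} (μ_{k−j} + 1)}). -/

import Mathlib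

open PowerSeries

noncomputable section

/-- The product (coefficientwise) topology on `ℚ⟦X⟧`. -/
instance : TopologicalSpace ℚ⟦X⟧ :=
  inferInstanceAs (TopologicalSpace ((Unit →₀ ℕ) → ℚ))

/-- `(q)_n = ∏_{i=1}^n (1 - q^i)` in `ℚ⟦X⟧`. -/
def qp (n : ℕ) : ℚ⟦X⟧ := ∏ i ∈ Finset.range n, (1 - X ^ (i + 1))

/-- `(-q)_n = ∏_{i=1}^n (1 + q^i)` in `ℚ⟦X⟧`. -/
def nqp (n : ℕ) : ℚ⟦X⟧ := ∏ i ∈ Finset.range n, (1 + X ^ (i + 1))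

/-- The Gaussian binomial `[M, N]_q`, zero unless `M ≥ N`. -/
def qbinom (M N : ℕ) : ℚ⟦X⟧ :=
  if N ≤ M then qp M * ((qp N)⁻¹ * (qp (M - N))⁻¹) else 0

/-- Weakly decreasing tuples `f 0 ≥ f 1 ≥ … ≥ f (r-1) ≥ 0`, encoded as
antitone functions `ℕ → ℕ` vanishing from index `r` on. -/
def DecTuple (r : ℕ) : Type :=
  {f : ℕ → ℕ // (∀ ⦃i j : ℕ⦄, i ≤ j → f j ≤ f i) ∧ ∀ i, r ≤ i → f i = 0}

/-- `(q)_λ = (q)_{λ_1-λ_2} ⋯ (q)_{λ_{r-1}-λ_r} (q)_{λ_r}` for a weakly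
decreasing tuple `λ` (0-indexed). -/
def qpT (r : ℕ) (f : ℕ → ℕ) : ℚ⟦X⟧ := ∏ i ∈ Finset.range r, qp (f i - f (i + 1))

section Topology

instance : T3Space ℚ⟦X⟧ := inferInstanceAs (T3Space ((Unit →₀ ℕ) → ℚ))

instance : IsTopologicalRing ℚ⟦X⟧ :=
  PowerSeries.WithPiTopology.instIsTopologicalRing ℚ

theorem continuous_coeff_rat (d : ℕ) : Continuous fun φ : ℚ⟦X⟧ => coeff d φ :=
  PowerSeries.WithPiTopology.continuous_coeff ℚ d

theorem tendsto_of_coeff_eventually_eq {f : ℕ → ℚ⟦X⟧} {a : ℚ⟦X⟧}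
    (h : ∀ d, ∀ᶠ n in Filter.atTop, coeff d (f n) = coeff d a) :
    Filter.Tendsto f Filter.atTop (nhds a) :=
  (PowerSeries.WithPiTopology.tendsto_iff_coeff_tendsto ℚ f Filter.atTop a).2 fun d =>
    tendsto_const_nhds.congr' ((h d).mono fun _ hn => hn.symm)

/-- A family of power series is coefficientwise finite if every coefficient vanishes for all but
finitely many members. -/
def CoeffFinite {ι : Type*} (F : ι → ℚ⟦X⟧) : Prop := ∀ d, {i | coeff d (F i) ≠ 0}.Finite

variable {ι κ : Type*} {F : ι → ℚ⟦X⟧}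

theorem CoeffFinite.comp_injective (hF : CoeffFinite F) {e : κ → ι}
    (he : Function.Injective e) : CoeffFinite fun i => F (e i) :=
  fun d => (hF d).preimage he.injOn

theorem CoeffFinite.summable (hF : CoeffFinite F) : Summable F :=
  ⟨PowerSeries.mk fun d => ∑' i, coeff d (F i),
    (PowerSeries.WithPiTopology.hasSum_iff_hasSum_coeff ℚ).2 fun d => by
      simpa using (summable_of_hasFiniteSupport (hF d)).hasSum⟩

theorem CoeffFinite.coeff_tsum (hF : CoeffFinite F) (d : ℕ) :
    coeff d (∑' i, F i) = ∑' i, coeff d (F i) :=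
  ((hF.summable.hasSum.map (coeff d) (continuous_coeff_rat d)).tsum_eq).symm

theorem coeffFinite_of_dvd (c : ι → ℕ) (hc : ∀ d, {i | c i ≤ d}.Finite)
    (h : ∀ i, X ^ c i ∣ F i) : CoeffFinite F := fun d =>
  (hc d).subset fun i hi => by
    by_contra hlt
    exact hi (X_pow_dvd_iff.1 (h i) d (not_le.1 hlt))

end Topology

section QSeries

theorem constantCoeff_qp (n : ℕ) : constantCoeff (qp n) = 1 := by
  simp [qp, map_prod]

theorem constantCoeff_nqp (n : ℕ) : constantCoeff (nqp n) = 1 := by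
  simp [nqp, map_prod]

theorem qp_mul_inv (n : ℕ) : qp n * (qp n)⁻¹ = 1 :=
  PowerSeries.mul_inv_cancel _ (by simp [constantCoeff_qp])

theorem one_sub_mul_inv_qp_succ (n : ℕ) :
    (1 - X ^ (n + 1)) * (qp (n + 1))⁻¹ = (qp n)⁻¹ := by
  have h := qp_mul_inv (n + 1)
  have h' := qp_mul_inv n
  have hs : qp (n + 1) = qp n * (1 - X ^ (n + 1)) := Finset.prod_range_succ _ n
  rw [hs] at h ⊢
  linear_combination (qp n)⁻¹ * h - (1 - X ^ (n + 1)) * (qp n * (1 - X ^ (n + 1)))⁻¹ * h'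

theorem prod_inv (s : Finset ℕ) (f : ℕ → ℚ⟦X⟧) : (∏ i ∈ s, f i)⁻¹ = ∏ i ∈ s, (f i)⁻¹ := by
  classical
  induction s using Finset.induction_on with
  | empty => simp
  | insert a s ha ih =>
    rw [Finset.prod_insert ha, Finset.prod_insert ha, PowerSeries.mul_inv_rev, ih, mul_comm]

theorem triangle_succ (n : ℕ) : (n + 1) * (n + 1 + 1) / 2 = n * (n + 1) / 2 + n + 1 := by
  rw [show (n + 1) * (n + 1 + 1) = n * (n + 1) + (n + 1) * 2 by ring,
    Nat.add_mul_div_right _ _ two_pos, add_assoc]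

theorem triangle_add (b j : ℕ) :
    (b + j) * (b + j + 1) / 2 = b * (b + 1) / 2 + (j * (j + 1) / 2 + b * j) := by
  induction j with
  | zero => simp
  | succ j ih => rw [← add_assoc, triangle_succ, triangle_succ, ih]; ring

theorem le_triangle (n : ℕ) : n ≤ n * (n + 1) / 2 := by
  induction n with
  | zero => simp
  | succ n ih => rw [triangle_succ]; omega

/-- The finite `q`-binomial sum. -/
theorem sum_qbinomial (b N : ℕ) :
    qp N * ∑ j ∈ Finset.range (N + 1),
      (X : ℚ⟦X⟧) ^ (j * (j + 1) / 2 + b * j) * (qp (N - j))⁻¹ * (qp j)⁻¹ =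
      ∏ i ∈ Finset.range N, (1 + X ^ (b + i + 1)) := by
  induction N with
  | zero => simp [qp]
  | succ N ih =>
    rw [Finset.prod_range_succ, ← ih, qp, Finset.prod_range_succ, ← qp, mul_assoc, mul_assoc]
    congr 1
    have key : ∀ j ∈ Finset.range (N + 2), (1 - (X : ℚ⟦X⟧) ^ (N + 1)) *
        (X ^ (j * (j + 1) / 2 + b * j) * (qp (N + 1 - j))⁻¹ * (qp j)⁻¹) =
        X ^ (j * (j + 1) / 2 + b * j) * ((1 - X ^ (N + 1 - j)) * (qp (N + 1 - j))⁻¹) * (qp j)⁻¹ +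
        X ^ (j * (j + 1) / 2 + b * j) * X ^ (N + 1 - j) * (qp (N + 1 - j))⁻¹ *
          ((1 - X ^ j) * (qp j)⁻¹) := fun j hj => by
      have hj : N + 1 - j + j = N + 1 := by have := Finset.mem_range.1 hj; omega
      have hX : (X : ℚ⟦X⟧) ^ (N + 1) = X ^ (N + 1 - j) * X ^ j := by rw [← pow_add, hj]
      rw [hX]; ring
    rw [Finset.mul_sum, Finset.sum_congr rfl key, Finset.sum_add_distrib,
      Finset.sum_range_succ, Finset.sum_range_succ' _ (N + 1)]
    simp only [Nat.sub_self, pow_zero, sub_self, zero_mul, mul_zero, add_zero]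
    rw [← Finset.sum_add_distrib, Finset.sum_mul]
    refine Finset.sum_congr rfl fun j hj => ?_
    have hj : j ≤ N := Nat.lt_succ_iff.1 (Finset.mem_range.1 hj)
    rw [one_sub_mul_inv_qp_succ, show N + 1 - j = N - j + 1 by omega, one_sub_mul_inv_qp_succ,
      show N + 1 - (j + 1) = N - j by omega, triangle_succ, ← pow_add,
      show j * (j + 1) / 2 + j + 1 + b * (j + 1) + (N - j) =
        j * (j + 1) / 2 + b * j + (b + N + 1) by rw [mul_add b]; omega]
    ring

theorem nqp_add (b N : ℕ) :
    nqp (b + N) = nqp b * ∏ i ∈ Finset.range N, (1 + X ^ (b + i + 1)) :=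
  Finset.prod_range_add _ b N

theorem nqp_mul_sum_qbinomial (b N : ℕ) :
    nqp b * ∑ j ∈ Finset.range (N + 1),
      (X : ℚ⟦X⟧) ^ ((b + j) * (b + j + 1) / 2) * (qp (N - j))⁻¹ * (qp j)⁻¹ =
      X ^ (b * (b + 1) / 2) * (qp N)⁻¹ * nqp (b + N) := by
  rw [nqp_add, ← sum_qbinomial]
  simp only [triangle_add, pow_add _ (b * (b + 1) / 2), mul_assoc, ← Finset.mul_sum]
  linear_combination (-nqp b * X ^ (b * (b + 1) / 2) * ∑ j ∈ Finset.range (N + 1),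
      (X : ℚ⟦X⟧) ^ (j * (j + 1) / 2 + b * j) * ((qp (N - j))⁻¹ * (qp j)⁻¹)) * qp_mul_inv N

theorem coeffFinite_euler (b : ℕ) :
    CoeffFinite fun t : ℕ => (X : ℚ⟦X⟧) ^ (t * (t + 1) / 2 + b * t) * (qp t)⁻¹ :=
  coeffFinite_of_dvd id (fun d => Set.finite_Iic d) fun t =>
    ((pow_dvd_pow _ ((le_triangle t).trans (Nat.le_add_right _ _))).mul_right _)

theorem tsum_euler_step (b : ℕ) :
    ∑' t : ℕ, (X : ℚ⟦X⟧) ^ (t * (t + 1) / 2 + b * t) * (qp t)⁻¹ =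
      (1 + X ^ (b + 1)) *
        ∑' t : ℕ, (X : ℚ⟦X⟧) ^ (t * (t + 1) / 2 + (b + 1) * t) * (qp t)⁻¹ := by
  have h1 := (coeffFinite_euler (b + 1)).summable
  have h2 := h1.hasSum.mul_left (X ^ (b + 1))
  have h3 : HasSum (fun t : ℕ => (X : ℚ⟦X⟧) ^ (t * (t + 1) / 2 + b * t) * (qp t)⁻¹ -
      (X : ℚ⟦X⟧) ^ (t * (t + 1) / 2 + (b + 1) * t) * (qp t)⁻¹) (X ^ (b + 1) *
        ∑' t : ℕ, (X : ℚ⟦X⟧) ^ (t * (t + 1) / 2 + (b + 1) * t) * (qp t)⁻¹) := by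
    rw [← hasSum_nat_add_iff' 1]
    simp only [Finset.range_one, Finset.sum_singleton, mul_zero, zero_mul, sub_self, sub_zero]
    convert! h2 using 2 with t
    rw [← one_sub_mul_inv_qp_succ t, triangle_succ,
      show t * (t + 1) / 2 + t + 1 + b * (t + 1) = b + 1 + (t * (t + 1) / 2 + (b + 1) * t) by ring,
      show t * (t + 1) / 2 + t + 1 + (b + 1) * (t + 1) =
        b + 1 + (t * (t + 1) / 2 + (b + 1) * t) + (t + 1) by ring]
    ring
  have h4 := h3.add h1.hasSum
  simp only [sub_add_cancel] at h4
  rw [h4.tsum_eq]; ring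

theorem tsum_euler_zero (b : ℕ) :
    ∑' t : ℕ, (X : ℚ⟦X⟧) ^ (t * (t + 1) / 2 + 0 * t) * (qp t)⁻¹ =
      nqp b * ∑' t : ℕ, (X : ℚ⟦X⟧) ^ (t * (t + 1) / 2 + b * t) * (qp t)⁻¹ := by
  induction b with
  | zero => simp [nqp]
  | succ b ih => rw [ih, tsum_euler_step, nqp, nqp, Finset.prod_range_succ, mul_assoc]

theorem tendsto_nqp :
    Filter.Tendsto nqp Filter.atTop (nhds (∏' i : ℕ, (1 + (X : ℚ⟦X⟧) ^ (i + 1)))) := by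
  refine Multipliable.tendsto_prod_tprod_nat
    (PowerSeries.WithPiTopology.multipliable_one_add_of_tendsto_order_atTop_nhds_top ℚ ?_)
  refine ENat.tendsto_nhds_top_iff_natCast_lt.2 fun n =>
    Filter.eventually_atTop.2 ⟨n, fun m hm => ?_⟩
  rw [order_X_pow]
  exact_mod_cast Nat.lt_succ_of_le hm

/-- Euler's identity for `(-q^{b+1})_∞`. -/
theorem nqp_mul_tsum_euler (b : ℕ) :
    nqp b * ∑' t : ℕ, (X : ℚ⟦X⟧) ^ (t * (t + 1) / 2 + b * t) * (qp t)⁻¹ =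
      ∏' i : ℕ, (1 + (X : ℚ⟦X⟧) ^ (i + 1)) := by
  rw [← tsum_euler_zero]
  have h : Filter.Tendsto
      (fun n => ∑' t : ℕ, (X : ℚ⟦X⟧) ^ (t * (t + 1) / 2 + n * t) * (qp t)⁻¹)
      Filter.atTop (nhds 1) := by
    refine tendsto_of_coeff_eventually_eq fun d => ?_
    filter_upwards [Filter.eventually_gt_atTop d] with n hn
    rw [(coeffFinite_euler n).coeff_tsum, tsum_eq_single 0]
    · simp [qp]
    · intro t ht
      refine X_pow_dvd_iff.1 (Dvd.dvd.mul_right (pow_dvd_pow X ?_) _) d hn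
      exact (Nat.le_mul_of_pos_right n (Nat.pos_of_ne_zero ht)).trans (Nat.le_add_left _ _)
  have h' := tendsto_nqp.mul h
  simp only [← tsum_euler_zero, mul_one] at h'
  exact tendsto_nhds_unique tendsto_const_nhds h'

end QSeries

section Interlacing

theorem finite_decTuple_le (r d : ℕ) : {f : DecTuple r | f.1 0 ≤ d}.Finite := by
  refine Set.Finite.of_injOn (f := fun f (i : Fin r) => f.1 i)
    (t := Set.pi Set.univ fun _ => Set.Iic d) (fun f hf i _ => (f.2.1 (Nat.zero_le _)).trans hf)
    (fun f _ g _ h => Subtype.ext (funext fun i => ?_))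
    (Set.Finite.pi fun _ => Set.finite_Iic d)
  by_cases hi : i < r
  · exact congrFun h ⟨i, hi⟩
  · rw [f.2.2 i (not_lt.1 hi), g.2.2 i (not_lt.1 hi)]

variable {k : ℕ}

/-- A decreasing `k`-tuple `g` with admissible excesses `h i` of an entry squeezed between
`g i` and `g (i + 1)`. -/
abbrev Squeezed (k : ℕ) : Type :=
  Σ g : DecTuple k, (i : Fin k) → Fin (g.1 i - g.1 (i + 1) + 1)

/-- The excess of the entry at the even index `2 * i`. -/
def excess (p : Squeezed k) (t : ℕ) : ℕ → ℕ
  | 0 => t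
  | i + 1 => if h : i < k then p.2 ⟨i, h⟩ else 0

theorem excess_le (p : Squeezed k) (t i : ℕ) :
    excess p t (i + 1) ≤ p.1.1 i - p.1.1 (i + 1) := by
  rw [excess]
  split_ifs with h
  · exact Nat.lt_succ_iff.1 (p.2 ⟨i, h⟩).2
  · exact Nat.zero_le _

/-- The interlaced `(2k+1)`-tuple with odd-indexed entries `g`. -/
def interlace (p : Squeezed k) (t n : ℕ) : ℕ :=
  p.1.1 (n / 2) + if n % 2 = 0 then excess p t (n / 2) else 0

theorem interlace_even (p : Squeezed k) (t i : ℕ) :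
    interlace p t (2 * i) = p.1.1 i + excess p t i := by
  simp [interlace]

theorem interlace_odd (p : Squeezed k) (t i : ℕ) : interlace p t (2 * i + 1) = p.1.1 i := by
  have h1 : (2 * i + 1) / 2 = i := by omega
  have h2 : (2 * i + 1) % 2 = 1 := by omega
  simp [interlace, h1, h2]

theorem interlace_succ_le (p : Squeezed k) (t n : ℕ) :
    interlace p t (n + 1) ≤ interlace p t n := by
  obtain ⟨i, rfl | rfl⟩ := n.even_or_odd'
  · rw [interlace_even, interlace_odd]
    exact Nat.le_add_right _ _
  · rw [show 2 * i + 1 + 1 = 2 * (i + 1) by ring, interlace_even, interlace_odd]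
    have h1 := excess_le p t i
    have h2 := p.1.2.1 (Nat.le_succ i)
    simp only [Nat.succ_eq_add_one] at h2
    omega

theorem interlace_eq_zero (p : Squeezed k) (t n : ℕ) (hn : 2 * k + 1 ≤ n) :
    interlace p t n = 0 := by
  obtain ⟨i, rfl | rfl⟩ := n.even_or_odd'
  · obtain ⟨i, rfl⟩ : ∃ j, i = j + 1 := ⟨i - 1, by omega⟩
    rw [interlace_even, p.1.2.2 _ (by omega), excess, dif_neg (by omega)]
  · rw [interlace_odd, p.1.2.2 _ (by omega)]

/-- `interlace` as a map into decreasing tuples. -/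
def interlaceTuple (x : Σ _ : Squeezed k, ℕ) : DecTuple (2 * k + 1) :=
  ⟨interlace x.1 x.2, antitone_nat_of_succ_le (interlace_succ_le x.1 x.2),
    interlace_eq_zero x.1 x.2⟩

theorem interlaceTuple_injective : Function.Injective (interlaceTuple (k := k)) := by
  rintro ⟨⟨g, h⟩, t⟩ ⟨⟨g', h'⟩, t'⟩ H
  have H (n : ℕ) : interlace ⟨g, h⟩ t n = interlace ⟨g', h'⟩ t' n :=
    congrFun (congrArg Subtype.val H) n
  obtain rfl : g = g' := Subtype.ext (funext fun i => by
    simpa only [interlace_odd] using H (2 * i + 1))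
  have E (i : ℕ) : excess ⟨g, h⟩ t i = excess ⟨g, h'⟩ t' i := by
    simpa only [interlace_even, Nat.add_left_cancel_iff] using H (2 * i)
  obtain rfl : t = t' := E 0
  obtain rfl : h = h' := funext fun i => Fin.ext (by simpa [excess] using E (i + 1))
  rfl

theorem interlaceTuple_surjective : Function.Surjective (interlaceTuple (k := k)) := by
  intro f
  refine ⟨⟨⟨⟨fun i => f.1 (2 * i + 1), fun i j hij => f.2.1 (by omega),
    fun i hi => f.2.2 _ (by omega)⟩, fun i => ⟨f.1 (2 * i + 2) - f.1 (2 * i + 3), ?_⟩⟩,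
    f.1 0 - f.1 1⟩, Subtype.ext (funext fun n => ?_)⟩
  · exact Nat.lt_succ_iff.2 (Nat.sub_le_sub_right (f.2.1 (by omega)) _)
  · obtain ⟨i, rfl | rfl⟩ := n.even_or_odd'
    · refine (interlace_even _ _ _).trans ?_
      cases i with
      | zero => exact Nat.add_sub_cancel' (f.2.1 (Nat.zero_le 1))
      | succ i =>
        by_cases hi : i < k
        · simp only [excess, dif_pos hi]
          exact Nat.add_sub_cancel' (f.2.1 (Nat.le_succ (2 * i + 2)))
        · simp only [excess, dif_neg hi]
          rw [f.2.2 _ (by omega), f.2.2 _ (by omega)]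
    · exact interlace_odd _ _ _

theorem prod_range_two_mul_add_one {M : Type*} [CommMonoid M] (a : ℕ → M) (k : ℕ) :
    ∏ i ∈ Finset.range (2 * k + 1), a i =
      a 0 * ∏ i ∈ Finset.range k, (a (2 * i + 1) * a (2 * (i + 1))) := by
  induction k with
  | zero => simp
  | succ k ih =>
    rw [show 2 * (k + 1) + 1 = 2 * k + 1 + 1 + 1 by ring, Finset.prod_range_succ,
      Finset.prod_range_succ, ih, Finset.prod_range_succ, mul_assoc, mul_assoc]
    rfl

theorem interlace_term (p : Squeezed k) (t : ℕ) :
    (X : ℚ⟦X⟧) ^ (∑ i ∈ Finset.range (2 * k + 1),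
        interlace p t i * (interlace p t i + 1) / 2) *
      (qpT (2 * k + 1) (interlace p t))⁻¹ =
    (X ^ (p.1.1 0 * (p.1.1 0 + 1) / 2) * ∏ i : Fin k,
        (X ^ (p.1.1 i * (p.1.1 i + 1) / 2) *
          (X ^ ((p.1.1 (i + 1) + p.2 i) * (p.1.1 (i + 1) + p.2 i + 1) / 2) *
            (qp (p.1.1 i - p.1.1 (i + 1) - p.2 i))⁻¹ * (qp (p.2 i))⁻¹))) *
      (X ^ (t * (t + 1) / 2 + p.1.1 0 * t) * (qp t)⁻¹) := by
  have hf (i : Fin k) : excess p t (i + 1) = p.2 i := by simp [excess]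
  have h0 : interlace p t 0 = p.1.1 0 + t := interlace_even p t 0
  have h1 : interlace p t (0 + 1) = p.1.1 0 := interlace_odd p t 0
  have h2 (i : ℕ) : 2 * i + 1 + 1 = 2 * (i + 1) := by ring
  rw [← Finset.prod_pow_eq_pow_sum, qpT, prod_inv, ← Finset.prod_mul_distrib,
    prod_range_two_mul_add_one, Finset.prod_range]
  simp only [h0, h1, h2, interlace_odd, interlace_even, hf, Nat.add_sub_cancel_left,
    triangle_add (p.1.1 0), pow_add X (p.1.1 0 * (p.1.1 0 + 1) / 2), Nat.sub_add_eq]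
  rw [mul_right_comm _ (∏ i : Fin k, _), ← mul_assoc]
  congr 1
  refine Finset.prod_congr rfl fun i _ => ?_
  ring

theorem mul_prod_range_shift {M : Type*} [CommMonoid M] (a : ℕ → M) (k : ℕ) (ha : a k = 1) :
    a 0 * ∏ i ∈ Finset.range k, a (i + 1) = ∏ i ∈ Finset.range k, a i := by
  rw [mul_comm, ← Finset.prod_range_succ', Finset.prod_range_succ, ha, mul_one]

theorem sum_excess (a b : ℕ) (hab : b ≤ a) :
    ∑ j : Fin (a - b + 1), (X : ℚ⟦X⟧) ^ (a * (a + 1) / 2) *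
      (X ^ ((b + j) * (b + j + 1) / 2) * (qp (a - b - j))⁻¹ * (qp j)⁻¹) =
    X ^ (a * (a + 1) / 2) * X ^ (b * (b + 1) / 2) * (qp (a - b))⁻¹ * nqp a * (nqp b)⁻¹ := by
  have h := nqp_mul_sum_qbinomial b (a - b)
  have hb : nqp b * (nqp b)⁻¹ = 1 :=
    PowerSeries.mul_inv_cancel _ (by simp [constantCoeff_nqp])
  rw [Nat.add_sub_cancel' hab] at h
  rw [← Finset.mul_sum, Fin.sum_univ_eq_sum_range
    (fun j => (X : ℚ⟦X⟧) ^ ((b + j) * (b + j + 1) / 2) * (qp (a - b - j))⁻¹ * (qp j)⁻¹)]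
  linear_combination X ^ (a * (a + 1) / 2) * (nqp b)⁻¹ * h -
    X ^ (a * (a + 1) / 2) * (∑ j ∈ Finset.range (a - b + 1),
      (X : ℚ⟦X⟧) ^ ((b + j) * (b + j + 1) / 2) * (qp (a - b - j))⁻¹ * (qp j)⁻¹) * hb

theorem sum_prod_excess (g : DecTuple k) :
    ∑ h : (i : Fin k) → Fin (g.1 i - g.1 (i + 1) + 1),
      (X : ℚ⟦X⟧) ^ (g.1 0 * (g.1 0 + 1) / 2) * ∏ i : Fin k,
        (X ^ (g.1 i * (g.1 i + 1) / 2) *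
          (X ^ ((g.1 (i + 1) + h i) * (g.1 (i + 1) + h i + 1) / 2) *
            (qp (g.1 i - g.1 (i + 1) - h i))⁻¹ * (qp (h i))⁻¹)) =
      nqp (g.1 0) * (X ^ (∑ i ∈ Finset.range k, (g.1 i ^ 2 + g.1 i)) * (qpT k g.1)⁻¹) := by
  have hk : g.1 k = 0 := g.2.2 k le_rfl
  have e1 := mul_prod_range_shift (fun i => (X : ℚ⟦X⟧) ^ (g.1 i * (g.1 i + 1) / 2)) k
    (by simp [hk])
  have e2 := mul_prod_range_shift (fun i => nqp (g.1 i)) k (by simp [hk, nqp])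
  have e3 : (∏ i ∈ Finset.range k, nqp (g.1 (i + 1))) *
      ∏ i ∈ Finset.range k, (nqp (g.1 (i + 1)))⁻¹ = 1 := by
    rw [← Finset.prod_mul_distrib]
    exact Finset.prod_eq_one fun i _ =>
      PowerSeries.mul_inv_cancel _ (by simp [constantCoeff_nqp])
  have e4 : (X : ℚ⟦X⟧) ^ (∑ i ∈ Finset.range k, (g.1 i ^ 2 + g.1 i)) =
      (∏ i ∈ Finset.range k, (X : ℚ⟦X⟧) ^ (g.1 i * (g.1 i + 1) / 2)) ^ 2 := by
    rw [← Finset.prod_pow_eq_pow_sum, ← Finset.prod_pow]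
    refine Finset.prod_congr rfl fun i _ => ?_
    rw [← pow_mul, Nat.div_mul_cancel (Nat.even_mul_succ_self _).two_dvd]
    ring
  have e5 := Finset.prod_univ_sum
    (fun i : Fin k => (Finset.univ : Finset (Fin (g.1 i - g.1 (i + 1) + 1))))
    (fun i j => (X : ℚ⟦X⟧) ^ (g.1 i * (g.1 i + 1) / 2) *
      (X ^ ((g.1 (i + 1) + j) * (g.1 (i + 1) + j + 1) / 2) *
        (qp (g.1 i - g.1 (i + 1) - j))⁻¹ * (qp j)⁻¹))
  rw [Fintype.piFinset_univ] at e5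
  rw [← Finset.mul_sum, ← e5, Finset.prod_congr rfl fun (i : Fin k) _ =>
    sum_excess (g.1 i) (g.1 (i + 1)) (g.2.1 (Nat.le_succ _)),
    Fin.prod_univ_eq_prod_range (fun i => (X : ℚ⟦X⟧) ^ (g.1 i * (g.1 i + 1) / 2) *
      X ^ (g.1 (i + 1) * (g.1 (i + 1) + 1) / 2) * (qp (g.1 i - g.1 (i + 1)))⁻¹ *
        nqp (g.1 i) * (nqp (g.1 (i + 1)))⁻¹) k, e4, qpT, prod_inv]
  simp only [Finset.prod_mul_distrib]
  rw [← e2, ← e1]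
  linear_combination X ^ (g.1 0 * (g.1 0 + 1) / 2) * X ^ (g.1 0 * (g.1 0 + 1) / 2) *
    (∏ i ∈ Finset.range k, (X : ℚ⟦X⟧) ^ (g.1 (i + 1) * (g.1 (i + 1) + 1) / 2)) ^ 2 *
    (∏ i ∈ Finset.range k, (qp (g.1 i - g.1 (i + 1)))⁻¹) * nqp (g.1 0) * e3

theorem coeffFinite_decTuple (r : ℕ) (F : DecTuple r → ℚ⟦X⟧) (a : ℕ → ℕ) (ha : ∀ n, n ≤ a n)
    (h : ∀ f, X ^ (∑ i ∈ Finset.range r, a (f.1 i)) ∣ F f) : CoeffFinite F := by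
  refine coeffFinite_of_dvd (fun f => f.1 0) (finite_decTuple_le r) fun f =>
    (pow_dvd_pow X ?_).trans (h f)
  rcases r.eq_zero_or_pos with rfl | hr
  · exact (f.2.2 0 le_rfl).le.trans (Nat.zero_le _)
  · exact (ha _).trans (Finset.single_le_sum (f := fun i => a (f.1 i))
      (fun _ _ => Nat.zero_le _) (Finset.mem_range.2 hr))

/-- Summing out the odd-position entries of a `(2k+1)`-tuple, for a weight that depends only on
the even-position entries. -/
theorem tsum_decTuple_odd_rank (W : DecTuple (2 * k + 1) → ℚ⟦X⟧) (V : DecTuple k → ℚ⟦X⟧)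
    (hWV : ∀ x, W (interlaceTuple x) = V x.1.1) :
    (∑' f : DecTuple (2 * k + 1),
        (X : ℚ⟦X⟧) ^ (∑ i ∈ Finset.range (2 * k + 1), f.1 i * (f.1 i + 1) / 2) *
          (qpT (2 * k + 1) f.1)⁻¹ * W f) =
      (∏' i : ℕ, (1 + (X : ℚ⟦X⟧) ^ (i + 1))) *
        ∑' g : DecTuple k,
          (X : ℚ⟦X⟧) ^ (∑ i ∈ Finset.range k, (g.1 i ^ 2 + g.1 i)) * (qpT k g.1)⁻¹ * V g := by
  have hL : CoeffFinite fun f : DecTuple (2 * k + 1) =>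
      (X : ℚ⟦X⟧) ^ (∑ i ∈ Finset.range (2 * k + 1), f.1 i * (f.1 i + 1) / 2) *
        (qpT (2 * k + 1) f.1)⁻¹ * W f :=
    coeffFinite_decTuple _ _ (fun n => n * (n + 1) / 2) le_triangle fun f =>
      (dvd_mul_right _ _).mul_right _
  have hR : CoeffFinite fun g : DecTuple k =>
      (X : ℚ⟦X⟧) ^ (∑ i ∈ Finset.range k, (g.1 i ^ 2 + g.1 i)) * (qpT k g.1)⁻¹ * V g :=
    coeffFinite_decTuple _ _ (fun n => n ^ 2 + n) (fun n => Nat.le_add_left _ _) fun f =>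
      (dvd_mul_right _ _).mul_right _
  have hL' := hL.comp_injective interlaceTuple_injective
  have hfib (p : Squeezed k) := hL'.comp_injective (sigma_mk_injective (i := p))
  have hsum := hL'.summable.hasSum.sigma fun p => (hfib p).summable.hasSum
  have hinner (p : Squeezed k) := (((coeffFinite_euler (p.1.1 0)).summable.hasSum.mul_left
    (X ^ (p.1.1 0 * (p.1.1 0 + 1) / 2) * ∏ i : Fin k,
        (X ^ (p.1.1 i * (p.1.1 i + 1) / 2) *
          (X ^ ((p.1.1 (i + 1) + p.2 i) * (p.1.1 (i + 1) + p.2 i + 1) / 2) *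
            (qp (p.1.1 i - p.1.1 (i + 1) - p.2 i))⁻¹ * (qp (p.2 i))⁻¹)))).mul_right (V p.1))
  rw [← (Equiv.ofBijective _ ⟨interlaceTuple_injective, interlaceTuple_surjective⟩).tsum_eq]
  refine hsum.tsum_eq.symm.trans ?_
  have hval (p : Squeezed k) := (hinner p).tsum_eq
  simp only [← interlace_term] at hval
  have hsum' := hsum.summable
  simp only [hWV] at hsum' ⊢
  simp only [interlaceTuple, hval] at hsum' ⊢
  rw [hsum'.tsum_sigma' fun g => (hasSum_fintype _).summable]
  simp only [tsum_fintype, ← Finset.sum_mul, sum_prod_excess]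
  rw [← hR.summable.tsum_mul_left]
  refine tsum_congr fun g => ?_
  rw [← nqp_mul_tsum_euler (g.1 0)]
  ring

end Interlacing

/-- Proposition for odd rank `r = 2k+1`  (`f.1 t` is `λ_{t+1}`, `g.1 t` is `μ_{t+1}`). -/
theorem stmt9 (k m : ℕ) (hk : 1 ≤ k) (hm : m ≤ k) :
    (∑' f : DecTuple (2 * k + 1),
        (X : ℚ⟦X⟧) ^ (∑ i ∈ Finset.range (2 * k + 1), f.1 i * (f.1 i + 1) / 2) *
          (qpT (2 * k + 1) f.1)⁻¹ *
          (1 + ∑ i ∈ Finset.range m,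
            (X : ℚ⟦X⟧) ^ ∑ j ∈ Finset.range (i + 1), (f.1 (2 * k - 1 - 2 * j) + 1))) =
      (∏' i : ℕ, (1 + (X : ℚ⟦X⟧) ^ (i + 1))) *
        ∑' g : DecTuple k,
          (X : ℚ⟦X⟧) ^ (∑ i ∈ Finset.range k, (g.1 i ^ 2 + g.1 i)) * (qpT k g.1)⁻¹ *
            (1 + ∑ i ∈ Finset.range m,
              (X : ℚ⟦X⟧) ^ ∑ j ∈ Finset.range (i + 1), (g.1 (k - 1 - j) + 1)) := by
  refine tsum_decTuple_odd_rank (fun f => 1 + ∑ i ∈ Finset.range m,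
    (X : ℚ⟦X⟧) ^ ∑ j ∈ Finset.range (i + 1), (f.1 (2 * k - 1 - 2 * j) + 1)) _ fun x => ?_
  refine congrArg (1 + ·) (Finset.sum_congr rfl fun i hi => congrArg (X ^ ·)
    (Finset.sum_congr rfl fun j hj => congrArg (· + 1) ?_))
  have hi := Finset.mem_range.1 hi
  have hj := Finset.mem_range.1 hj
  rw [show 2 * k - 1 - 2 * j = 2 * (k - 1 - j) + 1 by omega]
  exact interlace_odd _ _ _
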